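/- Under the standing hypotheses on q, λ, Φ_q, Φ_{q+λ}, W, f, K_c, K_p listed in the context, and assuming additionally that hypothesis (★) holds whenever ā₂ < ā₁, there exist real numbers a* < b* such that Γ(a*, b*) = 0 and γ(a*, b*) = 0. -/

import Mathlib

open MeasureTheory Filter Set Real

noncomputable section

/-- Tilted inventory-cost derivative integrand against the scale function:
`ρ_a(b) = ∫_a^b g(y) W(b - y) dy`. -/
def rho (W g : ℝ → ℝ) (a b : ℝ) : ℝ :=
  ∫ y in a..b, g y * W (b - y)

/-- `Γ(a, b)` of the paper (display (Gamma)). -/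
def Gam (lam Phiq Kp Kc : ℝ) (W g : ℝ → ℝ) (a b : ℝ) : ℝ :=
  (∫ y in Set.Ioi (0:ℝ), Real.exp (-Phiq * y) * g (y + a)) +
    lam * (∫ y in (0:ℝ)..(b - a), Real.exp (-Phiq * y) * rho W g a (y + a)) +
    lam / Phiq * Real.exp (-Phiq * (b - a)) * (Kp - Kc)

/-- `Γ₁(a) = Γ(a, a+)`. -/
def Gam1 (lam Phiq Kp Kc : ℝ) (g : ℝ → ℝ) (a : ℝ) : ℝ :=
  (∫ y in Set.Ioi (0:ℝ), Real.exp (-Phiq * y) * g (y + a)) + lam / Phiq * (Kp - Kc)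

/-- `Γ₂(a) = lim_{b→∞} Γ(a,b)/Θ(b-a)`. -/
def Gam2 (Phiql : ℝ) (g : ℝ → ℝ) (a : ℝ) : ℝ :=
  ∫ y in Set.Ioi (0:ℝ), Real.exp (-Phiql * y) * g (y + a)

/-- `Θ(x) = Θ^{(q+λ)}(x, Φ(q))`. -/
def Theta (lam Phiq : ℝ) (W : ℝ → ℝ) (x : ℝ) : ℝ :=
  1 + lam * (∫ y in (0:ℝ)..x, Real.exp (-Phiq * y) * W y)

/-- `γ(a,b) = -ρ_a(b) + K_p - K_c`. -/
def gam (Kp Kc : ℝ) (W g : ℝ → ℝ) (a b : ℝ) : ℝ :=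
  -(rho W g a b) + Kp - Kc

/-- `Z(x) = Z^{(q+λ)}(x) = 1 + (q+λ)∫₀^{x ∨ 0} W(y) dy`. -/
def Zfun (q lam : ℝ) (W : ℝ → ℝ) (x : ℝ) : ℝ :=
  1 + (q + lam) * (∫ y in (0:ℝ)..(max x 0), W y)

/-- Second scale function `Ẑ(x) = Z^{(q+λ)}(x, Φ(q))`. -/
def Zhat (lam Phiq : ℝ) (W : ℝ → ℝ) (x : ℝ) : ℝ :=
  Real.exp (Phiq * x) *
    (1 + lam * (∫ z in (0:ℝ)..(max x 0), Real.exp (-Phiq * z) * W z))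

open scoped Topology

theorem monotone_of_convexOn_rightDeriv {f f' : ℝ → ℝ} (hf : ConvexOn ℝ Set.univ f)
    (hd : ∀ x : ℝ, HasDerivWithinAt f (f' x) (Set.Ici x) x) : Monotone f' := by
  have h : ∀ x, derivWithin f (Ioi x) x = f' x := fun x =>
    (hd x).Ioi_of_Ici.derivWithin (uniqueDiffWithinAt_Ioi x)
  intro x y hxy
  have := hf.monotoneOn_rightDeriv (by simp : x ∈ interior univ) (by simp : y ∈ interior univ) hxy
  simpa [h] using this

theorem isBigO_exp_of_convexOn {f f' : ℝ → ℝ} (hf : ConvexOn ℝ Set.univ f)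
    (hd : ∀ x : ℝ, HasDerivWithinAt f (f' x) (Set.Ici x) x)
    (hgrowth : ∃ C M : ℝ, ∃ N : ℕ, 0 < C ∧ 0 < M ∧ ∀ x : ℝ, M < |x| → |f x| ≤ C * |x| ^ N)
    {c : ℝ} (hc : 0 < c) : f' =O[atTop] fun x => exp (c * x) := by
  obtain ⟨C, M, N, hC, hM, hb⟩ := hgrowth
  have h1 : f =O[atTop] fun x => exp (c * x) := by
    refine Asymptotics.IsBigO.trans ?_ (isLittleO_pow_exp_pos_mul_atTop N hc).isBigO
    refine Asymptotics.IsBigO.of_bound C ?_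
    filter_upwards [eventually_gt_atTop M] with x hx
    simpa using hb x (hx.trans_le (le_abs_self x))
  have h2 : (fun x => f (x + 1)) =O[atTop] fun x => exp (c * x) := by
    refine (h1.comp_tendsto (tendsto_atTop_add_const_right _ (1 : ℝ) tendsto_id)).trans ?_
    refine Asymptotics.IsBigO.of_bound (exp c) (Eventually.of_forall fun x => ?_)
    simp [mul_add, exp_add, mul_comm]
  have h3 : (fun _ : ℝ => f' 0) =O[atTop] fun x => exp (c * x) := by
    refine Asymptotics.IsBigO.of_bound |f' 0| ?_
    filter_upwards [eventually_ge_atTop 0] with x hx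
    have : 1 ≤ exp (c * x) := one_le_exp (by positivity)
    simpa using le_mul_of_one_le_right (abs_nonneg (f' 0)) this
  refine Asymptotics.IsBigO.trans (g := fun x => ‖f (x + 1)‖ + ‖f x‖ + ‖f' 0‖) ?_
    ((h2.norm_left.add h1.norm_left).add h3.norm_left)
  refine Asymptotics.IsBigO.of_bound 1 ?_
  filter_upwards [eventually_ge_atTop 0] with x hx
  have hlo : f' 0 ≤ f' x := monotone_of_convexOn_rightDeriv hf hd hx
  have hup : f' x ≤ f (x + 1) - f x := by
    have := hf.le_slope_of_hasDerivWithinAt_Ioi (mem_univ x) (mem_univ (x + 1)) (by linarith)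
      (hd x).Ioi_of_Ici
    simpa [slope_def_field] using this
  have e : ‖(‖f (x + 1)‖ + ‖f x‖ + ‖f' 0‖ : ℝ)‖ = |f (x + 1)| + |f x| + |f' 0| := by
    rw [Real.norm_of_nonneg (by positivity)]; rfl
  rw [e, one_mul, Real.norm_eq_abs, abs_le]
  constructor
  · linarith [neg_abs_le (f' 0), abs_nonneg (f x), abs_nonneg (f (x + 1))]
  · linarith [neg_abs_le (f x), le_abs_self (f (x + 1)), abs_nonneg (f' 0)]

theorem Monotone.integrableOn_Ioi_exp_mul {g : ℝ → ℝ} (hg : Monotone g)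
    (hO : ∀ c > 0, g =O[atTop] fun x => exp (c * x)) {θ : ℝ} (hθ : 0 < θ) (a : ℝ) :
    IntegrableOn (fun t => exp (-θ * t) * g t) (Ioi a) := by
  refine IntegrableOn.mono_set (t := Ici a) ?_ Ioi_subset_Ici_self
  have hloc : LocallyIntegrable (fun t => exp (-θ * t) * g t) := by
    have := hg.locallyIntegrable (μ := volume)
    exact this.continuous_mul (by fun_prop)
  refine (hloc.locallyIntegrableOn (Ici a)).integrableOn_of_isBigO_atTop
    (g := fun t => exp (-(θ / 2) * t)) ?_
    ⟨Ioi 0, Ioi_mem_atTop 0, exp_neg_integrableOn_Ioi 0 (by positivity)⟩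
  have := (Asymptotics.isBigO_refl (fun t : ℝ => exp (-θ * t)) atTop).mul
    (hO (θ / 2) (by positivity))
  refine this.congr_right fun t => ?_
  rw [← exp_add]; ring_nf

theorem setIntegral_Ioi_exp_mul_comp_add (g : ℝ → ℝ) (θ a : ℝ) :
    ∫ y in Ioi (0 : ℝ), exp (-θ * y) * g (y + a) =
      exp (θ * a) * ∫ t in Ioi a, exp (-θ * t) * g t := by
  rw [← integral_const_mul]
  have h := (measurePreserving_add_right (volume : Measure ℝ) a).setIntegral_preimage_emb
    (measurableEmbedding_addRight a) (fun t => exp (θ * a) * (exp (-θ * t) * g t)) (Ioi a)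
  rw [← h]
  have : (fun x => x + a) ⁻¹' Ioi a = Ioi 0 := by ext; simp
  rw [this]
  congr 1 with y
  rw [← mul_assoc, ← exp_add]; ring_nf

section Tail

variable {g : ℝ → ℝ} {θ : ℝ}

theorem Gam2_eq_exp_mul (θ : ℝ) (g : ℝ → ℝ) (a : ℝ) :
    Gam2 θ g a = exp (θ * a) * ∫ t in Ioi a, exp (-θ * t) * g t :=
  setIntegral_Ioi_exp_mul_comp_add g θ a

theorem integrableOn_exp_mul_comp_add
    (hint : ∀ a, IntegrableOn (fun t => exp (-θ * t) * g t) (Ioi a)) (a : ℝ) :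
    IntegrableOn (fun y => exp (-θ * y) * g (y + a)) (Ioi 0) := by
  have h := ((measurePreserving_add_right (volume : Measure ℝ) a).integrableOn_comp_preimage
    (measurableEmbedding_addRight a)).2 ((hint a).const_mul (exp (θ * a)))
  have e : (fun x => x + a) ⁻¹' Ioi a = Ioi 0 := by ext; simp
  rw [e] at h
  refine h.congr_fun (fun y _ => ?_) measurableSet_Ioi
  simp only [Function.comp]
  rw [← mul_assoc, ← exp_add]; ring_nf

theorem monotone_Gam2 (hg : Monotone g)
    (hint : ∀ a, IntegrableOn (fun t => exp (-θ * t) * g t) (Ioi a)) : Monotone (Gam2 θ g) := by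
  intro a b hab
  refine integral_mono (integrableOn_exp_mul_comp_add hint a)
    (integrableOn_exp_mul_comp_add hint b) fun y => ?_
  exact mul_le_mul_of_nonneg_left (hg (by linarith)) (exp_pos _).le

theorem intervalIntegrable_of_integrableOn_Ioi {φ : ℝ → ℝ} (h : ∀ a, IntegrableOn φ (Ioi a))
    (a b : ℝ) : IntervalIntegrable φ volume a b :=
  intervalIntegrable_iff.2 ((h (min a b)).mono_set Ioc_subset_Ioi_self)

theorem continuous_Gam2
    (hint : ∀ a, IntegrableOn (fun t => exp (-θ * t) * g t) (Ioi a)) :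
    Continuous (Gam2 θ g) := by
  have h : Gam2 θ g = fun a => exp (θ * a) *
      ((∫ t in Ioi (0 : ℝ), exp (-θ * t) * g t) - ∫ t in (0 : ℝ)..a, exp (-θ * t) * g t) := by
    ext a
    rw [Gam2_eq_exp_mul, ← intervalIntegral.integral_interval_add_Ioi' (b := a)
      (intervalIntegrable_of_integrableOn_Ioi hint 0 a) (hint a), add_sub_cancel_left]
  rw [h]
  have := intervalIntegral.continuous_primitive
    (intervalIntegrable_of_integrableOn_Ioi hint) 0
  fun_prop

theorem div_le_Gam2 (hθ : 0 < θ) (hint : ∀ a, IntegrableOn (fun t => exp (-θ * t) * g t) (Ioi a))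
    {a c : ℝ} (hc : ∀ t > a, c ≤ g t) : c / θ ≤ Gam2 θ g a := by
  have h : ∫ y in Ioi (0 : ℝ), exp (-θ * y) * c = c / θ := by
    rw [integral_mul_const, integral_exp_mul_Ioi (by linarith) 0]
    simp; field_simp
  rw [← h]
  refine setIntegral_mono_on ((exp_neg_integrableOn_Ioi 0 hθ).mul_const c)
    (integrableOn_exp_mul_comp_add hint a) measurableSet_Ioi fun y hy => ?_
  exact mul_le_mul_of_nonneg_left (hc _ (by have : 0 < y := hy; linarith)) (exp_pos _).le

theorem exists_forall_Gam2_neg (hθ : 0 < θ) (hg : Monotone g)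
    (hint : ∀ a, IntegrableOn (fun t => exp (-θ * t) * g t) (Ioi a)) {c : ℝ} (hc : g c < 0) :
    ∃ A, ∀ a ≤ A, Gam2 θ g a < 0 := by
  set P := ∫ t in Ioi c, exp (-θ * t) * g t
  have hlim : Tendsto (fun a => g c * (-(exp (-θ * c) / θ) + exp (-θ * a) / θ) + P)
      atBot atBot := by
    refine tendsto_atBot_add_const_right _ _ (Tendsto.const_mul_atTop_of_neg hc ?_)
    refine tendsto_atTop_add_const_left _ _ (Tendsto.atTop_div_const hθ ?_)
    exact tendsto_exp_atTop.comp (tendsto_id.const_mul_atBot_of_neg (by linarith))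
  obtain ⟨A, hA⟩ := eventually_atBot.1
    ((hlim.eventually_lt_atBot 0).and (eventually_le_atBot c))
  refine ⟨A, fun a ha => ?_⟩
  obtain ⟨h1, h2⟩ := hA a ha
  rw [Gam2_eq_exp_mul]
  refine mul_neg_of_pos_of_neg (exp_pos _) (lt_of_le_of_lt ?_ h1)
  rw [← intervalIntegral.integral_interval_add_Ioi' (b := c)
      (intervalIntegrable_of_integrableOn_Ioi hint a c) (hint c)]
  gcongr
  have h : ∫ t in a..c, exp (-θ * t) * g c = g c * (-(exp (-θ * c) / θ) + exp (-θ * a) / θ) := by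
    rw [intervalIntegral.integral_mul_const,
      intervalIntegral.integral_comp_mul_left (fun x => exp x) (neg_ne_zero.2 hθ.ne'),
      integral_exp, smul_eq_mul]
    field_simp; ring
  rw [← h]
  refine intervalIntegral.integral_mono_on h2 (intervalIntegrable_of_integrableOn_Ioi hint a c)
    ((by fun_prop : Continuous fun t => exp (-θ * t) * g c).intervalIntegrable a c) fun t ht => ?_
  exact mul_le_mul_of_nonneg_left (hg ht.2) (exp_pos _).le

end Tail

section Continuity

variable {g W : ℝ → ℝ}

theorem continuous_intervalIntegral_mul (hg : Monotone g) {k : ℝ → ℝ → ℝ}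
    (hk : Continuous (Function.uncurry k)) :
    Continuous fun p : ℝ × ℝ => ∫ t in (0 : ℝ)..p.2, g t * k p.1 t := by
  rw [continuous_iff_continuousAt]
  rintro ⟨x₀, b₀⟩
  set a := min 0 b₀ - 1
  set b := max 0 b₀ + 1
  have ha : a < 0 ∧ a < b₀ := by
    constructor <;> simp only [a] <;> linarith [min_le_left 0 b₀, min_le_right 0 b₀]
  have hb : 0 < b ∧ b₀ < b := by
    constructor <;> simp only [b] <;> linarith [le_max_left 0 b₀, le_max_right 0 b₀]
  obtain ⟨C, hC⟩ := (isCompact_Icc.prod isCompact_Icc :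
    IsCompact (Icc (x₀ - 1) (x₀ + 1) ×ˢ Icc a b)).exists_bound_of_continuousOn hk.continuousOn
  have hab : a ≤ b := by linarith
  refine intervalIntegral.continuousAt_parametric_primitive_of_dominated (F := fun x t => g t * k x t) (μ := volume)
    (fun t => ‖g t‖ * C) a b (fun x => ?_) ?_ ?_ ?_ ⟨ha.1, hb.1⟩ ⟨ha.2, hb.2⟩ (measure_singleton _)
  · exact (hg.measurable.aestronglyMeasurable.mul
      (by fun_prop : Continuous (k x)).aestronglyMeasurable).restrict
  · filter_upwards [Icc_mem_nhds (by linarith : x₀ - 1 < x₀) (by linarith : x₀ < x₀ + 1)] with x hx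
    refine (ae_restrict_iff' measurableSet_uIoc).2 (Eventually.of_forall fun t ht => ?_)
    rw [uIoc_of_le hab] at ht
    rw [norm_mul]
    exact mul_le_mul_of_nonneg_left (hC (x, t) ⟨hx, ht.1.le, ht.2⟩) (norm_nonneg _)
  · exact (hg.intervalIntegrable (μ := volume)).norm.mul_const C
  · refine Eventually.of_forall fun t => ?_
    exact ((by fun_prop : Continuous fun x => g t * k x t)).continuousAt

theorem intervalIntegrable_mul_comp_sub (hg : Monotone g) (hW : Continuous W)
    (b c d : ℝ) : IntervalIntegrable (fun y => g y * W (b - y)) volume c d :=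
  (hg.intervalIntegrable (μ := volume) (a := c) (b := d)).mul_continuousOn
    (by fun_prop : Continuous fun y => W (b - y)).continuousOn

theorem continuous_rho (hg : Monotone g) (hW : Continuous W) :
    Continuous fun p : ℝ × ℝ => rho W g p.1 p.2 := by
  have hF := continuous_intervalIntegral_mul hg (k := fun s t => W (s - t)) (by fun_prop)
  have h : (fun p : ℝ × ℝ => rho W g p.1 p.2) = fun p =>
      (∫ t in (0 : ℝ)..p.2, g t * W (p.2 - t)) - ∫ t in (0 : ℝ)..p.1, g t * W (p.2 - t) := by
    ext p
    rw [intervalIntegral.integral_interval_sub_left] <;>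
      first | rfl | exact intervalIntegrable_mul_comp_sub hg hW _ _ _
  rw [h]
  exact (hF.comp (continuous_snd.prodMk continuous_snd)).sub
    (hF.comp (continuous_snd.prodMk continuous_fst))

theorem Gam_eq (lam Phiq Kp Kc : ℝ) (W g : ℝ → ℝ) (a b : ℝ) :
    Gam lam Phiq Kp Kc W g a b = Gam2 Phiq g a +
      lam * (∫ t in a..b, exp (-Phiq * (t - a)) * rho W g a t) +
      lam / Phiq * exp (-Phiq * (b - a)) * (Kp - Kc) := by
  have h := intervalIntegral.integral_comp_add_right (a := 0) (b := b - a)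
    (fun t => exp (-Phiq * (t - a)) * rho W g a t) a
  simp only [add_sub_cancel_right, zero_add, sub_add_cancel] at h
  rw [← h]; rfl

theorem continuous_Gam (lam Phiq Kp Kc : ℝ) (hg : Monotone g) (hW : Continuous W)
    (hint : ∀ a, IntegrableOn (fun t => exp (-Phiq * t) * g t) (Ioi a)) :
    Continuous fun p : ℝ × ℝ => Gam lam Phiq Kp Kc W g p.1 p.2 := by
  have hρ := continuous_rho hg hW
  have hk : Continuous (Function.uncurry fun a t : ℝ => exp (-Phiq * (t - a)) * rho W g a t) := by
    have : Continuous fun p : ℝ × ℝ => exp (-Phiq * (p.2 - p.1)) * rho W g p.1 p.2 := by fun_prop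
    exact this
  have hF := intervalIntegral.continuous_parametric_primitive_of_continuous (μ := volume)
    (a₀ := 0) hk
  have hI := continuous_Gam2 hint
  have h : (fun p : ℝ × ℝ => Gam lam Phiq Kp Kc W g p.1 p.2) = fun p => Gam2 Phiq g p.1 +
      lam * ((∫ t in (0 : ℝ)..p.2, exp (-Phiq * (t - p.1)) * rho W g p.1 t) -
        ∫ t in (0 : ℝ)..p.1, exp (-Phiq * (t - p.1)) * rho W g p.1 t) +
      lam / Phiq * exp (-Phiq * (p.2 - p.1)) * (Kp - Kc) := by
    ext p
    have hc : Continuous fun t => exp (-Phiq * (t - p.1)) * rho W g p.1 t := by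
      have : Continuous fun t => rho W g p.1 t :=
        hρ.comp (Continuous.prodMk_right p.1 : Continuous fun t : ℝ => (p.1, t))
      fun_prop
    rw [Gam_eq, intervalIntegral.integral_interval_sub_left (hc.intervalIntegrable _ _)
      (hc.intervalIntegrable _ _)]
  rw [h]
  have h1 := hF.comp (continuous_fst.prodMk continuous_snd)
  have h2 := hF.comp (continuous_fst.prodMk continuous_fst : Continuous fun p : ℝ × ℝ => (p.1, p.1))
  simp only [Function.comp_def] at h1 h2
  fun_prop

theorem hasDerivAt_Gam {Phiq : ℝ} (hPhiq : Phiq ≠ 0) (lam Kp Kc : ℝ)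
    (hg : Monotone g) (hW : Continuous W) (a b : ℝ) :
    HasDerivAt (fun b => Gam lam Phiq Kp Kc W g a b)
      (-(lam * exp (-Phiq * (b - a)) * gam Kp Kc W g a b)) b := by
  have hρ : Continuous fun t => rho W g a t :=
    (continuous_rho hg hW).comp (Continuous.prodMk_right a : Continuous fun t : ℝ => (a, t))
  have hc : Continuous fun t => exp (-Phiq * (t - a)) * rho W g a t := by fun_prop
  have h1 := hc.integral_hasStrictDerivAt a b |>.hasDerivAt
  have h2 : HasDerivAt (fun b => exp (-Phiq * (b - a))) (exp (-Phiq * (b - a)) * (-Phiq)) b := by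
    simpa using (((hasDerivAt_id b).sub_const a).const_mul (-Phiq)).exp
  have h3 := ((h1.const_mul lam).const_add (Gam2 Phiq g a)).add
    ((h2.const_mul (lam / Phiq)).mul_const (Kp - Kc))
  simp only [Gam_eq]
  refine h3.congr_deriv ?_
  rw [gam]; field_simp; ring

end Continuity

section Estimates

variable {g W : ℝ → ℝ} {Φ a b c : ℝ}

/-- Comparing `W (b - y)` with `W (b - c) * exp (Φ * (c - y))` on either side of the sign change `c`
of `g` bounds `ρ_a(b)` by the tilted tail integral of `g`. -/
theorem rho_le_mul_Gam2 (hg : Monotone g) (hW : Continuous W) (hW0 : ∀ x, 0 ≤ W x)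
    (hWexp : MonotoneOn (fun x => exp (-Φ * x) * W x) (Ici 0))
    (hint : ∀ a, IntegrableOn (fun t => exp (-Φ * t) * g t) (Ioi a))
    (hneg : ∀ x < c, g x ≤ 0) (hpos : ∀ x > c, 0 ≤ g x) (hac : a ≤ c) (hcb : c ≤ b) :
    rho W g a b ≤ W (b - c) * exp (Φ * (c - a)) * Gam2 Φ g a := by
  have hab := hac.trans hcb
  have key : ∀ y ∈ Icc a b,
      g y * W (b - y) ≤ W (b - c) * exp (Φ * c) * (exp (-Φ * y) * g y) := by
    intro y hy
    have e : W (b - c) * exp (Φ * c) * (exp (-Φ * y) * g y) =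
        g y * (exp (Φ * (b - y)) * (exp (-Φ * (b - c)) * W (b - c))) := by
      have : exp (Φ * c) * exp (-Φ * y) = exp (Φ * (b - y)) * exp (-Φ * (b - c)) := by
        rw [← exp_add, ← exp_add]; ring_nf
      linear_combination (W (b - c) * g y) * this
    have e' : W (b - y) = exp (Φ * (b - y)) * (exp (-Φ * (b - y)) * W (b - y)) := by
      rw [← mul_assoc, ← exp_add]; simp
    rw [e, e']
    rcases lt_trichotomy y c with h | h | h
    · refine mul_le_mul_of_nonpos_left (mul_le_mul_of_nonneg_left ?_ (exp_pos _).le) (hneg y h)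
      exact hWexp (mem_Ici.2 (by linarith)) (mem_Ici.2 (by linarith [hy.2])) (by linarith)
    · rw [h]
    · refine mul_le_mul_of_nonneg_left (mul_le_mul_of_nonneg_left ?_ (exp_pos _).le) (hpos y h)
      exact hWexp (mem_Ici.2 (by linarith [hy.2])) (mem_Ici.2 (by linarith)) (by linarith)
  have hint' := intervalIntegrable_of_integrableOn_Ioi hint a b
  have h1 : rho W g a b ≤ W (b - c) * exp (Φ * c) * ∫ y in a..b, exp (-Φ * y) * g y := by
    rw [← intervalIntegral.integral_const_mul]
    exact intervalIntegral.integral_mono_on hab (intervalIntegrable_mul_comp_sub hg hW b a b)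
      (hint'.const_mul _) key
  have h2 : 0 ≤ ∫ y in Ioi b, exp (-Φ * y) * g y :=
    setIntegral_nonneg measurableSet_Ioi fun y hy =>
      mul_nonneg (exp_pos _).le (hpos y (hcb.trans_lt hy))
  have h3 : W (b - c) * exp (Φ * (c - a)) * Gam2 Φ g a =
      W (b - c) * exp (Φ * c) *
        ((∫ y in a..b, exp (-Φ * y) * g y) + ∫ y in Ioi b, exp (-Φ * y) * g y) := by
    rw [intervalIntegral.integral_interval_add_Ioi' hint' (hint b), Gam2_eq_exp_mul,
      show Φ * c = Φ * (c - a) + Φ * a by ring, exp_add]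
    ring
  rw [h3, mul_add]
  have h4 : 0 ≤ W (b - c) * exp (Φ * c) := mul_nonneg (hW0 _) (exp_pos _).le
  nlinarith [mul_nonneg h4 h2]

theorem rho_nonpos_of_le (hW0 : ∀ x, 0 ≤ W x) (hneg : ∀ x < c, g x ≤ 0) (hab : a ≤ b)
    (hbc : b ≤ c) : rho W g a b ≤ 0 := by
  rw [rho, intervalIntegral.integral_of_le hab, integral_Ioc_eq_integral_Ioo]
  exact setIntegral_nonpos measurableSet_Ioo fun y hy =>
    mul_nonpos_of_nonpos_of_nonneg (hneg y (hy.2.trans_le hbc)) (hW0 _)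

theorem rho_le_rho_of_le (hg : Monotone g) (hW : Continuous W) (hW0 : ∀ x, 0 ≤ W x)
    (hneg : ∀ x < c, g x ≤ 0) {a' : ℝ} (haa' : a ≤ a') (hac : a' ≤ c) :
    rho W g a b ≤ rho W g a' b := by
  rw [rho, ← intervalIntegral.integral_add_adjacent_intervals
    (intervalIntegrable_mul_comp_sub hg hW b a a') (intervalIntegrable_mul_comp_sub hg hW b a' b),
    rho]
  refine add_le_of_nonpos_left ?_
  rw [intervalIntegral.integral_of_le haa', integral_Ioc_eq_integral_Ioo]
  exact setIntegral_nonpos measurableSet_Ioo fun y hy =>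
    mul_nonpos_of_nonpos_of_nonneg (hneg y (hy.2.trans_le hac)) (hW0 _)

theorem le_mul_exp_of_tendsto {L : ℝ} (hWexp : MonotoneOn (fun x => exp (-Φ * x) * W x) (Ici 0))
    (hL : Tendsto (fun x => exp (-Φ * x) * W x) atTop (𝓝 L)) {x : ℝ} (hx : 0 ≤ x) :
    exp (-Φ * x) * W x ≤ L :=
  ge_of_tendsto hL (by
    filter_upwards [eventually_ge_atTop x] with y hy
    exact hWexp hx (hx.trans hy) hy)

theorem tendsto_exp_mul_rho (hg : Monotone g) (hW : Continuous W) (hW0 : ∀ x, 0 ≤ W x)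
    (hWexp : MonotoneOn (fun x => exp (-Φ * x) * W x) (Ici 0)) {L : ℝ}
    (hL : Tendsto (fun x => exp (-Φ * x) * W x) atTop (𝓝 L))
    (hint : ∀ a, IntegrableOn (fun t => exp (-Φ * t) * g t) (Ioi a)) (a : ℝ) :
    Tendsto (fun b => exp (-Φ * b) * rho W g a b) atTop
      (𝓝 (L * ∫ t in Ioi a, exp (-Φ * t) * g t)) := by
  have hLnn : 0 ≤ L := ge_of_tendsto' hL fun x => mul_nonneg (exp_pos _).le (hW0 x)
  have hlim : Tendsto (fun b => ∫ t in Ioi a, (Iic b).indicator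
      (fun t => (exp (-Φ * t) * g t) * (exp (-Φ * (b - t)) * W (b - t))) t) atTop
      (𝓝 (∫ t in Ioi a, (exp (-Φ * t) * g t) * L)) := by
    refine tendsto_integral_filter_of_dominated_convergence
      (fun t => ‖exp (-Φ * t) * g t‖ * L) ?_ ?_ ((hint a).norm.mul_const L) ?_
    · refine Eventually.of_forall fun b => AEStronglyMeasurable.indicator ?_ measurableSet_Iic
      have := hg.measurable
      have := hW.measurable
      exact Measurable.aestronglyMeasurable (by fun_prop)
    · refine Eventually.of_forall fun b => Eventually.of_forall fun t => ?_
      by_cases ht : t ∈ Iic b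
      · rw [indicator_of_mem ht, norm_mul]
        refine mul_le_mul_of_nonneg_left ?_ (norm_nonneg _)
        rw [Real.norm_of_nonneg (mul_nonneg (exp_pos _).le (hW0 _))]
        exact le_mul_exp_of_tendsto hWexp hL (sub_nonneg.2 ht)
      · rw [indicator_of_notMem ht, norm_zero]
        positivity
    · refine Eventually.of_forall fun t => ?_
      have h1 := hL.comp (tendsto_atTop_add_const_right _ (-t) tendsto_id)
      refine (h1.const_mul (exp (-Φ * t) * g t)).congr' ?_
      filter_upwards [eventually_ge_atTop t] with b hb
      rw [indicator_of_mem (show t ∈ Iic b from hb)]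
      simp [sub_eq_add_neg]
  rw [integral_mul_const, mul_comm] at hlim
  refine hlim.congr' ?_
  filter_upwards [eventually_ge_atTop a] with b hb
  rw [setIntegral_indicator measurableSet_Iic, Ioi_inter_Iic, rho,
    intervalIntegral.integral_of_le hb, ← integral_const_mul]
  congr 1 with t
  have : exp (-Φ * b) = exp (-Φ * t) * exp (-Φ * (b - t)) := by
    rw [← exp_add]; ring_nf
  rw [this]; ring

end Estimates

section Existence

theorem exists_gt_of_hasDerivAt_pos {φ : ℝ → ℝ} {d x : ℝ} (h : HasDerivAt φ d x) (hd : 0 < d) :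
    ∃ y > x, φ x < φ y := by
  have h1 : Tendsto (slope φ x) (𝓝[>] x) (𝓝 d) :=
    (hasDerivAt_iff_tendsto_slope.1 h).mono_left (nhdsWithin_mono _ fun y hy => ne_of_gt hy)
  obtain ⟨y, hy, hxy⟩ := ((h1.eventually_const_lt hd).and self_mem_nhdsWithin).exists
  exact ⟨y, hxy, (slope_pos_iff_of_le (le_of_lt hxy)).1 hy⟩

theorem tendsto_atTop_of_eventually_one_le_deriv {φ φ' : ℝ → ℝ} {c : ℝ}
    (hφ : ∀ x > c, HasDerivAt φ (φ' x) x) (h : ∀ᶠ x in atTop, 1 ≤ φ' x) :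
    Tendsto φ atTop atTop := by
  obtain ⟨B, hB⟩ := eventually_atTop.1 (h.and (eventually_gt_atTop c))
  refine tendsto_atTop_mono' _ ?_ (tendsto_atTop_add_const_right _ (φ B - B) tendsto_id)
  filter_upwards [eventually_ge_atTop B] with x hx
  have hd : ∀ y ∈ Ici B, HasDerivAt φ (φ' y) y := fun y hy => hφ y (hB y hy).2
  have := (convex_Ici B).mul_sub_le_image_sub_of_le_deriv (f := φ) (C := 1)
    (fun y hy => (hd y hy).continuousAt.continuousWithinAt)
    (fun y hy => (hd y (interior_subset hy)).differentiableAt.differentiableWithinAt)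
    (fun y hy => by
      rw [(hd y (interior_subset hy)).deriv]; exact (hB y (interior_subset hy)).1)
    B self_mem_Ici x hx hx
  simp only [id]; linarith

variable {q lam Φ Φ' Kp Kc L : ℝ} {W g : ℝ → ℝ} {a : ℝ}

theorem hasDerivAt_comp_sub_integral {φ : ℝ → ℝ} (hφ : Continuous φ) (a b : ℝ) :
    HasDerivAt (fun b => ∫ y in (0 : ℝ)..(b - a), φ y) (φ (b - a)) b :=
  ((hφ.integral_hasStrictDerivAt 0 (b - a)).hasDerivAt).comp_sub_const b a

/-- With `D = (q + λ) Θ - λ e^{-Φ (b - a)} Z`, positivity of the expression in the hypothesis says that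
`Γ(a, ·) / D` is strictly decreasing; it cannot stay below a negative constant, since
`Γ(a, ·) + ε D` tends to infinity for every `ε > 0`. -/
theorem exists_Gam_pos_of_star (hq : 0 < q) (hlam : 0 < lam) (hΦ : 0 < Φ) (hΦ' : Φ < Φ')
    (hK : Kp < Kc) (hg : Monotone g) (hW : Continuous W) (hW0 : ∀ x, 0 ≤ W x)
    (hWmono : MonotoneOn W (Ici 0))
    (hWexp : MonotoneOn (fun x => exp (-Φ' * x) * W x) (Ici 0)) (hLpos : 0 < L)
    (hL : Tendsto (fun x => exp (-Φ' * x) * W x) atTop (𝓝 L))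
    (hint : ∀ a, IntegrableOn (fun t => exp (-Φ' * t) * g t) (Ioi a))
    (ha : Gam2 Φ' g a = 0)
    (hstar : ∀ᶠ b in atTop, 0 <
      (Φ / q * Gam lam Φ Kp Kc W g a b - lam / q * exp (-Φ * (b - a)) * gam Kp Kc W g a b)
            * Zfun q lam W (b - a) / Theta lam Φ W (b - a)
          + (lam + q) / q * gam Kp Kc W g a b) :
    ∃ b > a, 0 < Gam lam Φ Kp Kc W g a b := by
  by_contra! hcon
  set h := fun b => Gam lam Φ Kp Kc W g a b
  set e := fun b => exp (-Φ * (b - a))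
  set Z := fun b => 1 + (q + lam) * ∫ y in (0 : ℝ)..(b - a), W y
  set D := fun b => (lam + q) * Theta lam Φ W (b - a) - lam * e b * Z b
  have hZ : ∀ b ≥ a, Zfun q lam W (b - a) = Z b := fun b hb => by
    simp only [Zfun, Z]; rw [max_eq_left (by linarith)]
  have hZpos : ∀ b ≥ a, 0 < Z b := fun b hb => by
    have := intervalIntegral.integral_nonneg (μ := volume) (by linarith : (0 : ℝ) ≤ b - a)
      fun y _ => hW0 y
    simp only [Z]; positivity
  have hΘpos : ∀ b ≥ a, 0 < Theta lam Φ W (b - a) := fun b hb => by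
    have := intervalIntegral.integral_nonneg (μ := volume) (by linarith : (0 : ℝ) ≤ b - a)
      fun y _ => mul_nonneg (exp_pos (-Φ * y)).le (hW0 y)
    simp only [Theta]; positivity
  have hh' : ∀ b, HasDerivAt h (-(lam * e b * gam Kp Kc W g a b)) b := fun b =>
    hasDerivAt_Gam hΦ.ne' lam Kp Kc hg hW a b
  have hD' : ∀ b, HasDerivAt D (lam * Φ * e b * Z b) b := fun b => by
    have h1 := hasDerivAt_comp_sub_integral hW a b
    have h2 := hasDerivAt_comp_sub_integral
      (by fun_prop : Continuous fun y => exp (-Φ * y) * W y) a b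
    have h3 : HasDerivAt e (e b * (-Φ)) b := by
      simpa [e] using (((hasDerivAt_id b).sub_const a).const_mul (-Φ)).exp
    have h4 := (((h2.const_mul lam).const_add 1).const_mul (lam + q)).sub
      ((h3.const_mul lam).mul ((h1.const_mul (q + lam)).const_add 1))
    refine h4.congr_deriv ?_
    simp only [e, Z]; ring
  have hDpos : ∀ b ≥ a, 0 < D b := by
    have hmono : MonotoneOn D (Ici a) := monotoneOn_of_deriv_nonneg (convex_Ici a)
      (fun b _ => (hD' b).continuousAt.continuousWithinAt)
      (fun b _ => (hD' b).differentiableAt.differentiableWithinAt)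
      (fun b hb => by
        rw [(hD' b).deriv]
        have := hZpos b (interior_subset hb)
        have : 0 < e b := exp_pos _
        positivity)
    intro b hb
    refine lt_of_lt_of_le ?_ (hmono self_mem_Ici hb hb)
    simp [D, Theta, Z, e, hq]
  obtain ⟨b₁, hb₁⟩ := eventually_atTop.1 (hstar.and (eventually_gt_atTop a))
  have hsign : ∀ b ≥ b₁, 0 < Φ * h b * Z b + gam Kp Kc W g a b * D b := fun b hb => by
    obtain ⟨h1, h2⟩ := hb₁ b hb
    have h3 := hΘpos b h2.le
    rw [hZ b h2.le] at h1
    have h4 := mul_pos h1 (mul_pos hq h3)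
    refine h4.trans_eq ?_
    simp only [D, h, e]; field_simp; ring
  have hV : StrictAntiOn (fun b => h b / D b) (Ici b₁) := by
    have hd : ∀ b ≥ b₁, HasDerivAt (fun b => h b / D b)
        (-(lam * e b) * (Φ * h b * Z b + gam Kp Kc W g a b * D b) / D b ^ 2) b := fun b hb => by
      refine ((hh' b).div (hD' b) (hDpos b (hb₁ b hb).2.le).ne').congr_deriv ?_
      congr 1; ring
    refine strictAntiOn_of_deriv_neg (convex_Ici b₁)
      (fun b hb => (hd b hb).continuousAt.continuousWithinAt) fun b hb => ?_
    have hb := interior_subset hb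
    rw [(hd b hb).deriv]
    have h1 := hsign b hb
    have h2 := hDpos b (hb₁ b hb).2.le
    have h3 : 0 < e b := exp_pos _
    exact div_neg_of_neg_of_pos (mul_neg_of_neg_of_pos (by nlinarith) h1) (by positivity)
  obtain ⟨δ, hδ, hhD⟩ : ∃ δ > 0, ∀ b ≥ b₁ + 1, h b ≤ -δ * D b := by
    have h0 := (hb₁ b₁ le_rfl).2
    have h1 : h b₁ / D b₁ ≤ 0 := div_nonpos_of_nonpos_of_nonneg (hcon b₁ h0) (hDpos b₁ h0.le).le
    have h2 := hV self_mem_Ici (show b₁ + 1 ∈ Ici b₁ by simp) (by linarith)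
    refine ⟨-(h (b₁ + 1) / D (b₁ + 1)), by simp only at h2; linarith, fun b hb => ?_⟩
    have h3 := hV.antitoneOn (show b₁ + 1 ∈ Ici b₁ by simp) (show b ∈ Ici b₁ by
      simp only [mem_Ici]; linarith) hb
    have h4 := hDpos b (by linarith)
    rw [neg_neg]
    exact (div_le_iff₀ h4).1 h3
  set u := fun b => h b + δ / 2 * D b
  have hu : Tendsto u atTop atTop := by
    refine tendsto_atTop_of_eventually_one_le_deriv (c := a)
      (fun b _ => (hh' b).add ((hD' b).const_mul (δ / 2))) ?_
    have hρ : Tendsto (fun b => exp (-Φ' * b) * rho W g a b) atTop (𝓝 0) := by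
      have := tendsto_exp_mul_rho hg hW hW0 hWexp hL hint a
      have h0 : ∫ t in Ioi a, exp (-Φ' * t) * g t = 0 := by
        rw [Gam2_eq_exp_mul] at ha
        exact (mul_eq_zero.1 ha).resolve_left (exp_pos _).ne'
      rwa [h0, mul_zero] at this
    have hWlim : Tendsto (fun b => exp (-Φ' * (b - (a + 1))) * W (b - (a + 1))) atTop (𝓝 L) :=
      hL.comp (tendsto_atTop_add_const_right _ _ tendsto_id)
    have hbr := hρ.add (hWlim.const_mul (δ / 2 * Φ * (q + lam) * exp (-Φ' * (a + 1))))
    have hexp : Tendsto (fun b => lam * exp (Φ * a) * exp ((Φ' - Φ) * b)) atTop atTop :=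
      (tendsto_exp_atTop.comp (tendsto_id.const_mul_atTop (by linarith))).const_mul_atTop
        (by positivity)
    have hpos : 0 < 0 + δ / 2 * Φ * (q + lam) * exp (-Φ' * (a + 1)) * L := by positivity
    filter_upwards [(hexp.atTop_mul_pos hpos hbr).eventually_ge_atTop 1,
      eventually_ge_atTop (a + 1)] with b h1 hb
    refine h1.trans ?_
    have hZW : (q + lam) * W (b - (a + 1)) ≤ Z b := by
      have i : ∀ c d : ℝ, IntervalIntegrable W volume c d := fun c d => hW.intervalIntegrable c d
      have h1 := intervalIntegral.integral_add_adjacent_intervals (i 0 (b - (a + 1)))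
        (i (b - (a + 1)) (b - a))
      have h2 := intervalIntegral.integral_nonneg (μ := volume)
        (by linarith : (0 : ℝ) ≤ b - (a + 1)) fun y _ => hW0 y
      have h3 : ∫ y in (b - (a + 1))..(b - a), W (b - (a + 1)) ≤
          ∫ y in (b - (a + 1))..(b - a), W y :=
        intervalIntegral.integral_mono_on (by linarith) (by simp) (i _ _) fun y hy =>
          hWmono (mem_Ici.2 (by linarith)) (mem_Ici.2 (by linarith [hy.1])) hy.1
      simp only [intervalIntegral.integral_const, sub_sub_sub_cancel_left, add_sub_cancel_left,
        one_smul] at h3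
      have : (q + lam) * W (b - (a + 1)) ≤ (q + lam) * ∫ y in (0 : ℝ)..(b - a), W y := by
        gcongr; linarith
      simp only [Z]; linarith
    have e1 : exp (Φ * a) * exp ((Φ' - Φ) * b) * exp (-Φ' * b) = e b := by
      simp only [e]; rw [← exp_add, ← exp_add]; ring_nf
    have e2 : exp (-Φ' * (a + 1)) * exp (-Φ' * (b - (a + 1))) = exp (-Φ' * b) := by
      rw [← exp_add]; ring_nf
    have e3 : lam * exp (Φ * a) * exp ((Φ' - Φ) * b) * (exp (-Φ' * b) * rho W g a b +
        δ / 2 * Φ * (q + lam) * exp (-Φ' * (a + 1)) *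
          (exp (-Φ' * (b - (a + 1))) * W (b - (a + 1)))) =
        lam * e b * (rho W g a b + δ / 2 * Φ * ((q + lam) * W (b - (a + 1)))) := by
      rw [← e1]
      linear_combination (lam * exp (Φ * a) * exp ((Φ' - Φ) * b) * δ / 2 * Φ * (q + lam) *
        W (b - (a + 1))) * e2
    have e4 : -(lam * e b * gam Kp Kc W g a b) + δ / 2 * (lam * Φ * e b * Z b) =
        lam * e b * (rho W g a b + (Kc - Kp) + δ / 2 * Φ * Z b) := by
      rw [gam]; ring
    rw [e3, e4]
    have : 0 < e b := exp_pos _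
    have h5 : δ / 2 * Φ * ((q + lam) * W (b - (a + 1))) ≤ δ / 2 * Φ * Z b := by gcongr
    have h6 : 0 < Kc - Kp := by linarith
    gcongr
    linarith
  obtain ⟨b, hb, hb'⟩ := ((hu.eventually_gt_atTop 0).and (eventually_ge_atTop (b₁ + 1))).exists
  have h1 := hhD b hb'
  have h2 := hDpos b (by linarith [(hb₁ b₁ le_rfl).2])
  simp only [u] at hb
  nlinarith

/-- The leftmost `a'` for which `Γ(a', ·)` reaches zero is attained at an interior maximum of
`Γ(a', ·)`, where the derivative, a negative multiple of `γ(a', ·)`, vanishes. -/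
theorem exists_barriers_of_Gam_pos (hlam : 0 < lam) (hΦ : 0 < Φ) (hΦ' : Φ < Φ')
    (hK : Kp < Kc) (hg : Monotone g) (hW : Continuous W) (hW0 : ∀ x, 0 ≤ W x)
    (hWexp : MonotoneOn (fun x => exp (-Φ' * x) * W x) (Ici 0)) (hLpos : 0 < L)
    (hL : Tendsto (fun x => exp (-Φ' * x) * W x) atTop (𝓝 L))
    (hint : ∀ θ > 0, ∀ a, IntegrableOn (fun t => exp (-θ * t) * g t) (Ioi a))
    {c : ℝ} (hneg : ∀ x < c, g x < 0) (hpos : ∀ x > c, 0 ≤ g x) (hac : a ≤ c)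
    (ha : ∀ x < a, Gam2 Φ' g x < 0) (hΓ : ∃ b > a, 0 < Gam lam Φ Kp Kc W g a b) :
    ∃ a' b', a' < b' ∧ Gam lam Φ Kp Kc W g a' b' = 0 ∧ gam Kp Kc W g a' b' = 0 := by
  have hΦ0 : 0 < Φ' := hΦ.trans hΦ'
  have hcont := continuous_Gam lam Φ Kp Kc hg hW (hint Φ hΦ)
  obtain ⟨b₀, hb₀, hΓb₀⟩ := hΓ
  obtain ⟨a₀, ha₀, hΓa₀⟩ : ∃ a₀ < a, 0 < Gam lam Φ Kp Kc W g a₀ b₀ := by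
    have h1 : Tendsto (fun x => Gam lam Φ Kp Kc W g x b₀) (𝓝[<] a)
        (𝓝 (Gam lam Φ Kp Kc W g a b₀)) :=
      ((hcont.comp (Continuous.prodMk_left b₀)).tendsto a).mono_left nhdsWithin_le_nhds
    obtain ⟨x, h, hx⟩ := ((h1.eventually_const_lt hΓb₀).and self_mem_nhdsWithin).exists
    exact ⟨x, hx, h⟩
  have hρ : ∀ x < a, ∀ t ≥ x, rho W g x t ≤ 0 := fun x hx t ht => by
    rcases le_total t c with h | h
    · exact rho_nonpos_of_le hW0 (fun y hy => (hneg y hy).le) ht h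
    · refine (rho_le_mul_Gam2 hg hW hW0 hWexp (hint Φ' hΦ0) (fun y hy => (hneg y hy).le) hpos
        (hx.le.trans hac) h).trans ?_
      exact mul_nonpos_of_nonneg_of_nonpos (mul_nonneg (hW0 _) (exp_pos _).le) (ha x hx).le
  have hint' : ∀ x y z s : ℝ,
      IntervalIntegrable (fun t => exp (-Φ * (t - s)) * rho W g x t) volume y z :=
    fun x y z s => by
      have : Continuous fun t => rho W g x t :=
        (continuous_rho hg hW).comp (Continuous.prodMk_right x : Continuous fun t : ℝ => (x, t))
      exact Continuous.intervalIntegrable (by fun_prop) _ _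
  have hlast : ∀ s, lam / Φ * exp (-Φ * s) * (Kp - Kc) ≤ 0 := fun s =>
    mul_nonpos_of_nonneg_of_nonpos (by positivity) (by linarith)
  obtain ⟨A, hA⟩ := exists_forall_Gam2_neg hΦ hg (hint Φ hΦ) (hneg (c - 1) (by linarith))
  set α := min A (a₀ - 1)
  have hαA : α ≤ A := min_le_left _ _
  have hαa : α < a₀ := (min_le_right _ _).trans_lt (by linarith)
  have hΓα : ∀ b ≥ α, Gam lam Φ Kp Kc W g α b < 0 := fun b hb => by
    have h1 : ∫ t in α..b, exp (-Φ * (t - α)) * rho W g α t ≤ 0 := by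
      rw [intervalIntegral.integral_of_le hb]
      exact setIntegral_nonpos measurableSet_Ioc fun t ht =>
        mul_nonpos_of_nonneg_of_nonpos (exp_pos _).le (hρ α (hαa.trans ha₀) t ht.1.le)
    rw [Gam_eq]
    have := mul_nonpos_of_nonneg_of_nonpos hlam.le h1
    linarith [hA α hαA, hlast (b - α)]
  obtain ⟨B, hB⟩ : ∃ B, ∀ x ∈ Icc α a₀, ∀ b ≥ B, Gam lam Φ Kp Kc W g x b < 0 := by
    have htend : Tendsto (fun b => ∫ t in a₀..b, -(exp (-Φ * (t - α)) * rho W g a₀ t))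
        atTop atTop := by
      have hc : Continuous fun t => rho W g a₀ t :=
        (continuous_rho hg hW).comp (Continuous.prodMk_right a₀ : Continuous fun t : ℝ => (a₀, t))
      refine tendsto_atTop_of_eventually_one_le_deriv (c := 0) (fun b _ =>
        ((by fun_prop : Continuous fun t =>
          -(exp (-Φ * (t - α)) * rho W g a₀ t)).integral_hasStrictDerivAt a₀ b).hasDerivAt) ?_
      have h1 := (tendsto_exp_mul_rho hg hW hW0 hWexp hL (hint Φ' hΦ0) a₀).neg
      have hexp : Tendsto (fun b => exp (Φ * α) * exp ((Φ' - Φ) * b)) atTop atTop :=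
        (tendsto_exp_atTop.comp (tendsto_id.const_mul_atTop (by linarith))).const_mul_atTop
          (by positivity)
      have h2 : 0 < -(L * ∫ t in Ioi a₀, exp (-Φ' * t) * g t) := by
        have := ha a₀ ha₀
        rw [Gam2_eq_exp_mul] at this
        have := neg_of_mul_neg_right this (exp_pos _).le
        nlinarith
      refine ((hexp.atTop_mul_pos h2 h1).eventually_ge_atTop 1).mono fun b hb => ?_
      refine hb.trans_eq ?_
      have : exp (Φ * α) * exp ((Φ' - Φ) * b) * exp (-Φ' * b) = exp (-Φ * (b - α)) := by
        rw [← exp_add, ← exp_add]; ring_nf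
      rw [← this]; ring
    obtain ⟨B, hB⟩ := eventually_atTop.1
      ((htend.eventually_gt_atTop (Gam2 Φ g a₀ / lam)).and (eventually_ge_atTop a₀))
    refine ⟨B, fun x hx b hb => ?_⟩
    obtain ⟨h1, h2⟩ := hB b hb
    rw [intervalIntegral.integral_neg, div_lt_iff₀ hlam] at h1
    have h3 := monotone_Gam2 hg (hint Φ hΦ) hx.2
    have h4 : ∫ t in x..b, exp (-Φ * (t - x)) * rho W g x t ≤
        ∫ t in a₀..b, exp (-Φ * (t - α)) * rho W g a₀ t := by
      rw [← intervalIntegral.integral_add_adjacent_intervals (hint' x x a₀ x) (hint' x a₀ b x)]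
      have h5 : ∫ t in x..a₀, exp (-Φ * (t - x)) * rho W g x t ≤ 0 := by
        rw [intervalIntegral.integral_of_le hx.2]
        exact setIntegral_nonpos measurableSet_Ioc fun t ht =>
          mul_nonpos_of_nonneg_of_nonpos (exp_pos _).le
            (hρ x (hx.2.trans_lt ha₀) t ht.1.le)
      have h6 := intervalIntegral.integral_mono_on h2 (hint' x a₀ b x) (hint' a₀ a₀ b α)
        fun t ht => by
          have h7 : rho W g x t ≤ rho W g a₀ t := rho_le_rho_of_le hg hW hW0
            (fun y hy => (hneg y hy).le) hx.2 (ha₀.le.trans hac)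
          have h8 : exp (-Φ * (t - α)) ≤ exp (-Φ * (t - x)) := exp_le_exp.2 (by nlinarith [hx.1])
          have h9 := hρ a₀ ha₀ t ht.1
          have h10 := exp_pos (-Φ * (t - x))
          nlinarith
      linarith
    rw [Gam_eq]
    have := mul_le_mul_of_nonneg_left h4 hlam.le
    linarith [hlast (b - x)]
  set S := (Icc α a₀ ×ˢ Icc α B) ∩ {p : ℝ × ℝ | p.1 ≤ p.2 ∧ 0 ≤ Gam lam Φ Kp Kc W g p.1 p.2}
  have hmem : ∀ x ∈ Icc α a₀, ∀ b ≥ x, 0 ≤ Gam lam Φ Kp Kc W g x b → (x, b) ∈ S :=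
    fun x hx b hb h => ⟨⟨hx, hx.1.trans hb, by
      by_contra! h'; exact absurd (hB x hx b h'.le) h.not_gt⟩, hb, h⟩
  have hS : IsCompact S := (isCompact_Icc.prod isCompact_Icc).inter_right
    ((isClosed_le continuous_fst continuous_snd).inter (isClosed_le continuous_const hcont))
  obtain ⟨⟨x, b⟩, hxb, hmin⟩ := hS.exists_isMinOn
    ⟨(a₀, b₀), hmem a₀ ⟨hαa.le, le_rfl⟩ b₀ (by linarith) hΓa₀.le⟩ continuous_fst.continuousOn
  obtain ⟨⟨hx, -⟩, hle, h0⟩ := hxb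
  simp only at hx hle h0
  have hαx : α < x := by
    refine lt_of_le_of_ne hx.1 ?_
    rintro rfl
    exact absurd (hΓα b hle) h0.not_gt
  have hmax : ∀ t ≥ x, Gam lam Φ Kp Kc W g x t ≤ 0 := by
    intro t ht
    by_contra! h
    have h1 : Tendsto (fun s => Gam lam Φ Kp Kc W g s t) (𝓝[<] x)
        (𝓝 (Gam lam Φ Kp Kc W g x t)) :=
      ((hcont.comp (Continuous.prodMk_left t)).tendsto x).mono_left nhdsWithin_le_nhds
    obtain ⟨s, h, hs⟩ := ((h1.eventually_const_lt h).and (Ioo_mem_nhdsLT hαx)).exists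
    have := hmin (hmem s ⟨hs.1.le, hs.2.le.trans hx.2⟩ t (hs.2.le.trans ht) h.le)
    exact absurd this (by simpa using hs.2)
  have hzero : Gam lam Φ Kp Kc W g x b = 0 := le_antisymm (hmax b hle) h0
  have hder := hasDerivAt_Gam hΦ.ne' lam Kp Kc hg hW x
  have hlt : x < b := by
    refine lt_of_le_of_ne hle ?_
    rintro rfl
    obtain ⟨y, hy, hy'⟩ := exists_gt_of_hasDerivAt_pos (hder x) (by
      simp [gam, rho]; nlinarith)
    exact absurd (hmax y hy.le) (by rw [hzero] at hy'; exact hy'.not_ge)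
  have hloc : IsLocalMax (fun b => Gam lam Φ Kp Kc W g x b) b := by
    filter_upwards [Ioi_mem_nhds hlt] with t ht
    rw [hzero]
    exact hmax t (le_of_lt ht)
  have hcrit := hloc.hasDerivAt_eq_zero (hder b)
  refine ⟨x, b, hlt, hzero, ?_⟩
  have : lam * exp (-Φ * (b - x)) ≠ 0 := by positivity
  exact (mul_eq_zero.1 (neg_eq_zero.1 hcrit)).resolve_left this

end Existence

section Extension

variable {W : ℝ → ℝ}

/-- `ρ` only sees `W` on the nonnegative half-line, so `W` may be replaced by its continuous extension. -/
theorem rho_comp_max (W g : ℝ → ℝ) {a b : ℝ} (hab : a ≤ b) :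
    rho (fun x => W (max x 0)) g a b = rho W g a b := by
  refine intervalIntegral.integral_congr fun y hy => ?_
  rw [uIcc_of_le hab] at hy
  simp [hy.2]

theorem gam_comp_max (Kp Kc : ℝ) (W g : ℝ → ℝ) {a b : ℝ} (hab : a ≤ b) :
    gam Kp Kc (fun x => W (max x 0)) g a b = gam Kp Kc W g a b := by
  rw [gam, gam, rho_comp_max W g hab]

theorem Gam_comp_max (lam Phiq Kp Kc : ℝ) (W g : ℝ → ℝ) {a b : ℝ} (hab : a ≤ b) :
    Gam lam Phiq Kp Kc (fun x => W (max x 0)) g a b = Gam lam Phiq Kp Kc W g a b := by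
  have : ∫ t in a..b, exp (-Phiq * (t - a)) * rho (fun x => W (max x 0)) g a t =
      ∫ t in a..b, exp (-Phiq * (t - a)) * rho W g a t := by
    refine intervalIntegral.integral_congr fun t ht => ?_
    rw [uIcc_of_le hab] at ht
    simp only [rho_comp_max W g ht.1]
  rw [Gam_eq, Gam_eq, this]

theorem Theta_comp_max (lam Phiq : ℝ) (W : ℝ → ℝ) {x : ℝ} (hx : 0 ≤ x) :
    Theta lam Phiq (fun x => W (max x 0)) x = Theta lam Phiq W x := by
  have : ∫ y in (0 : ℝ)..x, exp (-Phiq * y) * W (max y 0) =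
      ∫ y in (0 : ℝ)..x, exp (-Phiq * y) * W y := by
    refine intervalIntegral.integral_congr fun t ht => ?_
    rw [uIcc_of_le hx] at ht
    simp [ht.1]
  rw [Theta, Theta, this]

theorem Zfun_comp_max (q lam : ℝ) (W : ℝ → ℝ) (x : ℝ) :
    Zfun q lam (fun x => W (max x 0)) x = Zfun q lam W x := by
  have : ∫ y in (0 : ℝ)..(max x 0), W (max y 0) = ∫ y in (0 : ℝ)..(max x 0), W y := by
    refine intervalIntegral.integral_congr fun t ht => ?_
    rw [uIcc_of_le (le_max_right x 0)] at ht
    simp [ht.1]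
  rw [Zfun, Zfun, this]

theorem monotoneOn_exp_mul_of_ratio {Φ : ℝ} (hWnn : ∀ x ≥ (0 : ℝ), 0 ≤ W x)
    (hWcont : ContinuousOn W (Ici 0)) (hWmono : StrictMonoOn W (Ici 0))
    (hmono : ∀ a y : ℝ, a < y → MonotoneOn (fun b => W (b - y) / W (b - a)) (Ioi y))
    (hlim : ∀ a y : ℝ, a < y →
      Tendsto (fun b => W (b - y) / W (b - a)) atTop (𝓝 (exp (-Φ * (y - a))))) :
    MonotoneOn (fun x => exp (-Φ * x) * W x) (Ici 0) := by
  have hpos : ∀ s t, 0 < s → s < t → exp (-Φ * s) * W s ≤ exp (-Φ * t) * W t := by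
    intro s t hs hst
    have hW : 0 < W t := (hWnn 0 le_rfl).trans_lt
      (hWmono self_mem_Ici (hs.trans hst).le (hs.trans hst))
    have hys : t - s ∈ Iio t := by simpa using hs
    have h : W s / W t ≤ exp (-Φ * (t - s)) := by
      refine ge_of_tendsto (by simpa using hlim 0 (t - s) (by linarith)) ?_
      filter_upwards [eventually_ge_atTop t] with b hb
      simpa using hmono 0 (t - s) (by linarith) hys (show t - s < b by linarith [hys.out]) hb
    rw [div_le_iff₀ hW] at h
    calc exp (-Φ * s) * W s ≤ exp (-Φ * s) * (exp (-Φ * (t - s)) * W t) := by gcongr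
      _ = exp (-Φ * t) * W t := by rw [← mul_assoc, ← exp_add]; ring_nf
  intro s hs t _ hst
  rcases hst.eq_or_lt with rfl | hlt
  · exact le_rfl
  rcases (show (0 : ℝ) ≤ s from hs).eq_or_lt with rfl | h0
  · have hc : ContinuousWithinAt (fun x => exp (-Φ * x) * W x) (Ioi 0) 0 :=
      (((by fun_prop : Continuous fun x => exp (-Φ * x)).continuousOn.mul hWcont) 0
        self_mem_Ici).mono Ioi_subset_Ici_self
    refine le_of_tendsto hc ?_
    filter_upwards [Ioo_mem_nhdsGT hlt] with x hx
    exact hpos x t hx.1 hx.2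
  · exact hpos s t h0 hlt

end Extension

/-- Theorem 5.6 (existence of candidate barriers with Γ(a*,b*) = γ(a*,b*) = 0). -/
theorem existence_of_candidate_barriers
    (q lam Phiq Phiql : ℝ) (hq : 0 < q) (hlam : 0 < lam)
    (hPhiq : 0 < Phiq) (hPhi : Phiq < Phiql)
    (W : ℝ → ℝ)
    (hW0 : ∀ x < (0:ℝ), W x = 0)
    (hWnn : ∀ x ≥ (0:ℝ), 0 ≤ W x)
    (hWcont : ContinuousOn W (Set.Ici 0))
    (hWmono : StrictMonoOn W (Set.Ici 0))
    (hWC1 : ContDiffOn ℝ 1 W (Set.Ioi 0))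
    (hWratio_mono : ∀ a y : ℝ, a < y →
      MonotoneOn (fun b => W (b - y) / W (b - a)) (Set.Ioi y))
    (hWratio_lim : ∀ a y : ℝ, a < y →
      Filter.Tendsto (fun b => W (b - y) / W (b - a)) Filter.atTop
        (nhds (Real.exp (-Phiql * (y - a)))))
    (hWasymp : ∃ L : ℝ, 0 < L ∧
      Filter.Tendsto (fun x => Real.exp (-Phiql * x) * W x) Filter.atTop (nhds L))
    (f f' : ℝ → ℝ)
    (hf_conv : ConvexOn ℝ Set.univ f)
    (hf_deriv : ∀ x : ℝ, HasDerivWithinAt f (f' x) (Set.Ici x) x)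
    (hf_pw : ∃ E : Set ℝ, E.Countable ∧ ∀ x ∉ E, ContinuousAt f' x)
    (hf_growth : ∃ C M : ℝ, ∃ N : ℕ, 0 < C ∧ 0 < M ∧
      ∀ x : ℝ, M < |x| → |f x| ≤ C * |x| ^ N)
    (Kc Kp : ℝ) (hK : Kp < Kc)
    (g : ℝ → ℝ) (hg : ∀ x : ℝ, g x = f' x + q * Kc + lam * (Kc - Kp))
    (habar_ne : {a : ℝ | 0 ≤ g a}.Nonempty)
    (habar_bdd : BddBelow {a : ℝ | 0 ≤ g a})
    (habb_ne : {a : ℝ | 0 < f' a + q * Kp}.Nonempty)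
    (habb_bdd : BddBelow {a : ℝ | 0 < f' a + q * Kp})
    (a1 a2 : ℝ)
    (ha1 : a1 = sInf {a : ℝ | 0 ≤ Gam1 lam Phiq Kp Kc g a})
    (ha2 : a2 = sInf {a : ℝ | 0 ≤ Gam2 Phiql g a})
    (hstar : a2 < a1 →
      (Filter.Tendsto (fun b =>
          (Phiq / q * Gam lam Phiq Kp Kc W g a2 b
              - lam / q * Real.exp (-Phiq * (b - a2)) * gam Kp Kc W g a2 b)
            * Zfun q lam W (b - a2) / Theta lam Phiq W (b - a2)
          + (lam + q) / q * gam Kp Kc W g a2 b) Filter.atTop Filter.atTop ∨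
      ∃ L : ℝ, 0 < L ∧ Filter.Tendsto (fun b =>
          (Phiq / q * Gam lam Phiq Kp Kc W g a2 b
              - lam / q * Real.exp (-Phiq * (b - a2)) * gam Kp Kc W g a2 b)
            * Zfun q lam W (b - a2) / Theta lam Phiq W (b - a2)
          + (lam + q) / q * gam Kp Kc W g a2 b) Filter.atTop (nhds L))) :
    ∃ astar bstar : ℝ, astar < bstar ∧
      Gam lam Phiq Kp Kc W g astar bstar = 0 ∧
      gam Kp Kc W g astar bstar = 0 := by
  have hf' : Monotone f' := monotone_of_convexOn_rightDeriv hf_conv hf_deriv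
  have hgmono : Monotone g := fun x y hxy => by rw [hg, hg]; linarith [hf' hxy]
  have hK' : 0 < Kc - Kp := by linarith
  have hPhiql : 0 < Phiql := hPhiq.trans hPhi
  have hint : ∀ θ > 0, ∀ a, IntegrableOn (fun t => exp (-θ * t) * g t) (Ioi a) := by
    refine fun θ hθ a => hgmono.integrableOn_Ioi_exp_mul (fun c hc => ?_) hθ a
    have h1 := isBigO_exp_of_convexOn hf_conv hf_deriv hf_growth hc
    have h2 : (fun _ : ℝ => q * Kc + lam * (Kc - Kp)) =O[atTop] fun x => exp (c * x) :=
      (Asymptotics.isLittleO_const_left.2 (Or.inr (tendsto_norm_atTop_atTop.comp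
        (tendsto_exp_atTop.comp (tendsto_id.const_mul_atTop hc))))).isBigO
    refine (h1.add h2).congr_left fun x => ?_
    rw [hg]; ring
  set c := sInf {a : ℝ | 0 ≤ g a}
  have hneg : ∀ x < c, g x < 0 := fun x hx => by
    have := notMem_of_lt_csInf hx habar_bdd
    simpa using this
  have hpos : ∀ x > c, 0 ≤ g x := fun x hx => by
    obtain ⟨y, hy, hyx⟩ := exists_lt_of_csInf_lt habar_ne hx
    exact (show 0 ≤ g y from hy).trans (hgmono hyx.le)
  have hbdd : ∀ θ > 0, ∃ A, ∀ a ≤ A, Gam2 θ g a < 0 := fun θ hθ =>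
    exists_forall_Gam2_neg hθ hgmono (hint θ hθ) (hneg (c - 1) (by linarith))
  have hS2 : BddBelow {a : ℝ | 0 ≤ Gam2 Phiql g a} := by
    obtain ⟨A, hA⟩ := hbdd Phiql hPhiql
    exact ⟨A, fun x hx => not_lt.1 fun h => (hA x h.le).not_ge hx⟩
  have hc2 : 0 ≤ Gam2 Phiql g c := by
    simpa using div_le_Gam2 hPhiql (hint Phiql hPhiql) hpos
  have ha2c : a2 ≤ c := ha2 ▸ csInf_le hS2 hc2
  have ha2neg : ∀ x < a2, Gam2 Phiql g x < 0 := fun x hx => by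
    simpa using notMem_of_lt_csInf (ha2 ▸ hx) hS2
  have hcont2 := continuous_Gam2 (hint Phiql hPhiql)
  have ha2zero : Gam2 Phiql g a2 = 0 := by
    refine le_antisymm ?_ ?_
    · refine le_of_tendsto (hcont2.continuousWithinAt (s := Iio a2)) ?_
      filter_upwards [self_mem_nhdsWithin] with x hx using (ha2neg x hx).le
    · have : a2 ∈ {a : ℝ | 0 ≤ Gam2 Phiql g a} :=
        ha2 ▸ (isClosed_le continuous_const hcont2).csInf_mem ⟨c, hc2⟩ hS2
      exact this
  obtain ⟨L, hLpos, hL⟩ := hWasymp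
  set V : ℝ → ℝ := fun x => W (max x 0)
  have hVW : ∀ x ≥ 0, V x = W x := fun x hx => by simp only [V, max_eq_left hx]
  have hV : Continuous V :=
    hWcont.comp_continuous (by fun_prop) fun x => mem_Ici.2 (le_max_right x 0)
  have hV0 : ∀ x, 0 ≤ V x := fun x => hWnn _ (le_max_right x 0)
  have hVmono : MonotoneOn V (Ici 0) := fun x hx y hy hxy => by
    rw [hVW x hx, hVW y hy]
    exact hWmono.monotoneOn hx hy hxy
  have hVexp : MonotoneOn (fun x => exp (-Phiql * x) * V x) (Ici 0) :=
    (monotoneOn_exp_mul_of_ratio hWnn hWcont hWmono hWratio_mono hWratio_lim).congr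
      fun x hx => by simp only [hVW x hx]
  have hVL : Tendsto (fun x => exp (-Phiql * x) * V x) atTop (𝓝 L) :=
    hL.congr' ((eventually_ge_atTop 0).mono fun x hx => by simp only [hVW x hx])
  have hΓ : ∃ b > a2, 0 < Gam lam Phiq Kp Kc V g a2 b := by
    rcases lt_or_ge a2 a1 with h | h
    · refine exists_Gam_pos_of_star hq hlam hPhiq hPhi hK hgmono hV hV0 hVmono hVexp hLpos hVL
        (hint Phiql hPhiql) ha2zero ?_
      have hev := (hstar h).elim (fun h => h.eventually_gt_atTop 0)
        fun ⟨l, hl, h⟩ => h.eventually_const_lt hl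
      filter_upwards [hev, eventually_ge_atTop a2] with b hb hab
      rwa [Gam_comp_max lam Phiq Kp Kc W g hab, gam_comp_max Kp Kc W g hab, Zfun_comp_max,
        Theta_comp_max lam Phiq W (sub_nonneg.2 hab)]
    · have hmono1 := monotone_Gam2 hgmono (hint Phiq hPhiq)
      have hGam1 : ∀ a, Gam1 lam Phiq Kp Kc g a = Gam2 Phiq g a + lam / Phiq * (Kp - Kc) :=
        fun a => rfl
      have hbdd1 : BddBelow {a : ℝ | 0 ≤ Gam1 lam Phiq Kp Kc g a} := by
        obtain ⟨A, hA⟩ := hbdd Phiq hPhiq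
        refine ⟨A, fun x hx => not_lt.1 fun h => ?_⟩
        have h1 := hA x h.le
        have h2 : 0 < lam / Phiq * (Kc - Kp) := by positivity
        have h3 : 0 ≤ Gam1 lam Phiq Kp Kc g x := hx
        rw [hGam1] at h3
        linarith
      have hne1 : {a : ℝ | 0 ≤ Gam1 lam Phiq Kp Kc g a}.Nonempty := by
        obtain ⟨x, hx⟩ := habb_ne
        refine ⟨x, ?_⟩
        have h1 : lam * (Kc - Kp) / Phiq ≤ Gam2 Phiq g x :=
          div_le_Gam2 hPhiq (hint Phiq hPhiq) fun t ht => by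
            have h2 : 0 < f' x + q * Kp := hx
            have h3 := hf' (le_of_lt ht)
            rw [hg]
            nlinarith
        have h4 : lam * (Kc - Kp) / Phiq = -(lam / Phiq * (Kp - Kc)) := by ring
        rw [mem_ofPred_eq, hGam1]
        linarith
      have hcont1 : Continuous (Gam1 lam Phiq Kp Kc g) :=
        (continuous_Gam2 (hint Phiq hPhiq)).add continuous_const
      have h1 : 0 ≤ Gam1 lam Phiq Kp Kc g a1 := by
        have : a1 ∈ {a : ℝ | 0 ≤ Gam1 lam Phiq Kp Kc g a} :=
          ha1 ▸ (isClosed_le continuous_const hcont1).csInf_mem hne1 hbdd1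
        exact this
      have h2 : 0 ≤ Gam lam Phiq Kp Kc V g a2 a2 := by
        have h3 := hmono1 h
        rw [hGam1] at h1
        rw [Gam_eq]
        simp
        linarith
      obtain ⟨b, hb, hb'⟩ := exists_gt_of_hasDerivAt_pos
        (hasDerivAt_Gam hPhiq.ne' lam Kp Kc hgmono hV a2 a2) (by simp [gam, rho]; nlinarith)
      exact ⟨b, hb, h2.trans_lt hb'⟩
  obtain ⟨x, b, hxb, h1, h2⟩ := exists_barriers_of_Gam_pos hlam hPhiq hPhi hK hgmono hV hV0
    hVexp hLpos hVL hint hneg hpos ha2c ha2neg hΓ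
  exact ⟨x, b, hxb, (Gam_comp_max lam Phiq Kp Kc W g hxb.le).symm.trans h1,
    (gam_comp_max Kp Kc W g hxb.le).symm.trans h2⟩
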